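/- Let 0 < T_1 < T_2 < ⋯ < T_N = T and let μ_1, …, μ_N be Borel probability measures on (0,∞)^d, each with finite first moments and with ∫ x_k dμ_i(x) = 1 for every coordinate k = 1,…,d and every i = 1,…,N. Assume μ_1 ⪯ μ_2 ⪯ ⋯ ⪯ μ_N in convex order. Then there exists a martingale measure Q on the path space Ω = D (a probability measure on D under which each S_t is Q-integrable and (S_t)_{t∈[0,T]} is a martingale with respect to the canonical filtration) such that for every i = 1,…,N the law of S_{T_i} under Q equals μ_i. -/

import Mathlib

open MeasureTheory Filter Set

noncomputable section

/-- `ℝ^d` with the Euclidean norm. -/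
abbrev E (d : ℕ) : Type := EuclideanSpace ℝ (Fin d)

/-- `f` is càdlàg on `[0,T]`: right-continuous on `[0,T)` and with left limits on `(0,T]`. -/
def IsCadlagOn (d : ℕ) (T : ℝ) (f : ℝ → E d) : Prop :=
  (∀ t ∈ Set.Ico (0:ℝ) T, Tendsto f (nhdsWithin t (Set.Ioo t T)) (nhds (f t))) ∧
  (∀ t ∈ Set.Ioc (0:ℝ) T, ∃ L, Tendsto f (nhdsWithin t (Set.Ico 0 t)) (nhds L))

/-- `f` is (left-)continuous at maturity `t = T`. -/
def ContinuousAtMaturity (d : ℕ) (T : ℝ) (f : ℝ → E d) : Prop :=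
  Tendsto f (nhdsWithin T (Set.Ico 0 T)) (nhds (f T))

/-- The path space `D`: càdlàg paths with values in `(0,∞)^d`, starting at `(1,…,1)`,
continuous at `T`. -/
def DPos (d : ℕ) (T : ℝ) : Set (ℝ → E d) :=
  {f | IsCadlagOn d T f ∧ ContinuousAtMaturity d T f ∧ (∀ i, f 0 i = 1) ∧
    ∀ t ∈ Set.Icc (0:ℝ) T, ∀ i, 0 < f t i}

/-- The σ-algebra on the path space generated by the coordinate maps `ω ↦ ω(t)`, `t ∈ [0,T]`. -/
instance pathSigma (d : ℕ) (T : ℝ) : MeasurableSpace ↥(DPos d T) :=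
  ⨆ t : Set.Icc (0:ℝ) T,
    MeasurableSpace.comap (fun ω : ↥(DPos d T) => (ω : ℝ → E d) t.1) inferInstance

/-- The canonical filtration `F_s = σ(S_u : 0 ≤ u ≤ s)`. -/
def canFilt (d : ℕ) (T s : ℝ) : MeasurableSpace ↥(DPos d T) :=
  ⨆ u : {u : ℝ // 0 ≤ u ∧ u ≤ s},
    MeasurableSpace.comap (fun ω : ↥(DPos d T) => (ω : ℝ → E d) u.1) inferInstance

/-- `Q` is a martingale measure: a probability measure on the path space under which each
coordinate process `S_t`, `t ∈ [0,T]`, is integrable and a martingale for the canonical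
filtration. -/
def IsMartingaleMeasure (d : ℕ) (T : ℝ) (Q : Measure ↥(DPos d T)) : Prop :=
  IsProbabilityMeasure Q ∧
  (∀ t ∈ Set.Icc (0:ℝ) T, Integrable (fun ω : ↥(DPos d T) => (ω : ℝ → E d) t) Q) ∧
  ∀ s t : ℝ, 0 ≤ s → s ≤ t → t ≤ T → ∀ i : Fin d,
    (fun ω : ↥(DPos d T) => (ω : ℝ → E d) s i)
      =ᵐ[Q] Q[(fun ω : ↥(DPos d T) => (ω : ℝ → E d) t i)|canFilt d T s]

/-- Convex order on (probability) measures on `ℝ^d`: `μ ⪯ ν` iff `∫ Φ dμ ≤ ∫ Φ dν` for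
every convex `Φ : ℝ^d → ℝ` integrable with respect to both. -/
def ConvexOrder (d : ℕ) (μ ν : Measure (E d)) : Prop :=
  ∀ Φ : E d → ℝ, ConvexOn ℝ Set.univ Φ → Integrable Φ μ → Integrable Φ ν →
    ∫ x, Φ x ∂μ ≤ ∫ x, Φ x ∂ν

theorem st_key_pos {d : ℕ} (μ ν : Measure (E d)) [IsProbabilityMeasure μ] [IsProbabilityMeasure ν]
    (hμ : Integrable (id : E d → E d) μ) (hν : Integrable (id : E d → E d) ν)
    (hc : ConvexOrder d μ ν) (a b : E d → ℝ) (ha : Integrable a μ) (hb : Integrable b ν)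
    (C : ℝ) (hbC : ∀ y, |b y| ≤ C * (1 + ‖y‖)) (h : E d → E d)
    (hpos : ∀ x y, 0 ≤ a x + b y + inner ℝ (h x) (y - x)) :
    0 ≤ ∫ x, a x ∂μ + ∫ x, b x ∂ν := by
  set F : E d → E d → ℝ := fun x y => - a x - inner ℝ (h x) (y - x) with hF
  set Φ : E d → ℝ := fun y => ⨆ x, F x y with hΦ
  have hFb : ∀ x y, F x y ≤ b y := fun x y => by
    have := hpos x y
    simp only [hF]; linarith
  have hbdd : ∀ y, BddAbove (Set.range fun x => F x y) := fun y =>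
    ⟨b y, by rintro _ ⟨x, rfl⟩; exact hFb x y⟩
  have hFΦ : ∀ x y, F x y ≤ Φ y := fun x y => le_ciSup (hbdd y) x
  have hΦb : ∀ y, Φ y ≤ b y := fun y => ciSup_le fun x => hFb x y
  have hconv : ConvexOn ℝ Set.univ Φ := by
    refine ⟨convex_univ, ?_⟩
    intro y _ z _ s t hs ht hst
    refine ciSup_le fun x => ?_
    have e : F x (s • y + t • z) = s * F x y + t * F x z := by
      simp only [hF]
      have : s • y + t • z - x = s • (y - x) + t • (z - x) := by
        have : x = (s + t) • x := by rw [hst, one_smul]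
        nth_rewrite 1 [this]
        module
      rw [this, inner_add_right, inner_smul_right, inner_smul_right]
      have : a x = (s + t) * a x := by rw [hst, one_mul]
      linear_combination -this
    rw [e, smul_eq_mul, smul_eq_mul]
    exact add_le_add (mul_le_mul_of_nonneg_left (hFΦ x y) hs)
      (mul_le_mul_of_nonneg_left (hFΦ x z) ht)
  have hcont : Continuous Φ := by
    rw [← continuousOn_univ]; exact hconv.continuousOn isOpen_univ
  have hbound : ∀ y, ‖Φ y‖ ≤ |C| * (1 + ‖y‖) + |a 0| + ‖h 0‖ * ‖y‖ := by
    intro y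
    have h1 := hFΦ 0 y
    have h2 := hΦb y
    have h3 := (le_abs_self _).trans (hbC y)
    have h4 : C * (1 + ‖y‖) ≤ |C| * (1 + ‖y‖) :=
      mul_le_mul_of_nonneg_right (le_abs_self C) (by positivity)
    have h5 := real_inner_le_norm (h 0) y
    have h6 : 0 ≤ |C| * (1 + ‖y‖) := by positivity
    have h7 : 0 ≤ ‖h 0‖ * ‖y‖ := by positivity
    have h8 := le_abs_self (a 0)
    have h9 := abs_nonneg (a 0)
    simp only [hF, sub_zero] at h1
    rw [Real.norm_eq_abs, abs_le]
    constructor <;> linarith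
  have hint : ∀ ρ : Measure (E d), IsProbabilityMeasure ρ → Integrable (id : E d → E d) ρ →
      Integrable Φ ρ := by
    intro ρ _ hρ
    have hn : Integrable (fun y : E d => ‖y‖) ρ := hρ.norm
    refine Integrable.mono' (g := fun y => |C| * (1 + ‖y‖) + |a 0| + ‖h 0‖ * ‖y‖) ?_
      hcont.aestronglyMeasurable (Eventually.of_forall hbound)
    exact ((((integrable_const 1).add hn).const_mul _).add (integrable_const _)).add
      (hn.const_mul _)
  have i1 := hint μ inferInstance hμ
  have i2 := hint ν inferInstance hν
  have h1 := hc Φ hconv i1 i2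
  have h2 : ∫ x, Φ x ∂ν ≤ ∫ x, b x ∂ν := integral_mono i2 hb hΦb
  have h3 : ∫ x, - a x ∂μ ≤ ∫ x, Φ x ∂μ := integral_mono ha.neg i1 fun x => by
    have := hFΦ x x
    simpa [hF] using this
  rw [integral_neg] at h3
  linarith

/-- continuous functions of linear growth -/
def StLG (d : ℕ) : Submodule ℝ (E d → ℝ) where
  carrier := {a | Continuous a ∧ ∃ C, ∀ x, |a x| ≤ C * (1 + ‖x‖)}
  add_mem' := by
    rintro a b ⟨ha, C, hC⟩ ⟨hb, C', hC'⟩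
    refine ⟨ha.add hb, C + C', fun x => ?_⟩
    have := abs_add_le (a x) (b x)
    have := hC x
    have := hC' x
    simp only [Pi.add_apply]
    linarith
  zero_mem' := ⟨continuous_const, 0, fun x => by simp⟩
  smul_mem' := by
    rintro c a ⟨ha, C, hC⟩
    refine ⟨ha.const_smul c, |c| * C, fun x => ?_⟩
    have := mul_le_mul_of_nonneg_left (hC x) (abs_nonneg c)
    simp only [Pi.smul_apply, smul_eq_mul, abs_mul]
    linarith

theorem st_lg_int {d : ℕ} (μ : Measure (E d)) [IsProbabilityMeasure μ]
    (hμ : Integrable (id : E d → E d) μ) (a : StLG d) : Integrable a.1 μ := by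
  obtain ⟨a, ha, C, hC⟩ := a
  have hn : Integrable (fun y : E d => ‖y‖) μ := hμ.norm
  exact Integrable.mono' (((integrable_const 1).add hn).const_mul C)
    ha.aestronglyMeasurable (Eventually.of_forall hC)

open scoped BoundedContinuousFunction in
abbrev StP (d : ℕ) : Type := StLG d × StLG d × (E d →ᵇ E d)

def stJ {d : ℕ} (p : StP d) (z : E d × E d) : ℝ :=
  p.1.1 z.1 + p.2.1.1 z.2 + inner ℝ (p.2.2 z.1) (z.2 - z.1)

theorem stJ_add {d : ℕ} (p q : StP d) (z : E d × E d) : stJ (p + q) z = stJ p z + stJ q z := by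
  simp [stJ, inner_add_left]; ring

theorem stJ_smul {d : ℕ} (c : ℝ) (p : StP d) (z : E d × E d) : stJ (c • p) z = c * stJ p z := by
  simp [stJ, inner_smul_left]; ring

theorem stJ_cont {d : ℕ} (p : StP d) : Continuous (stJ p) := by
  unfold stJ
  have h1 := p.1.2.1
  have h2 := p.2.1.2.1
  have h3 := p.2.2.continuous
  exact ((h1.comp continuous_fst).add (h2.comp continuous_snd)).add
    ((h3.comp continuous_fst).inner (continuous_snd.sub continuous_fst))

theorem stJ_bound {d : ℕ} (p : StP d) :
    ∃ C, 0 ≤ C ∧ ∀ z, |stJ p z| ≤ C * (1 + ‖z.1‖ + ‖z.2‖) := by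
  obtain ⟨C1, h1⟩ := p.1.2.2
  obtain ⟨C2, h2⟩ := p.2.1.2.2
  refine ⟨|C1| + |C2| + ‖p.2.2‖, by positivity, fun z => ?_⟩
  have e1 : |p.1.1 z.1| ≤ |C1| * (1 + ‖z.1‖ + ‖z.2‖) := (h1 z.1).trans <| by
    refine (mul_le_mul_of_nonneg_right (le_abs_self C1) (by positivity)).trans ?_
    exact mul_le_mul_of_nonneg_left (by linarith [norm_nonneg z.2]) (abs_nonneg _)
  have e2 : |p.2.1.1 z.2| ≤ |C2| * (1 + ‖z.1‖ + ‖z.2‖) := (h2 z.2).trans <| by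
    refine (mul_le_mul_of_nonneg_right (le_abs_self C2) (by positivity)).trans ?_
    exact mul_le_mul_of_nonneg_left (by linarith [norm_nonneg z.1]) (abs_nonneg _)
  have e3 : |inner ℝ (p.2.2 z.1) (z.2 - z.1)| ≤ ‖p.2.2‖ * (1 + ‖z.1‖ + ‖z.2‖) := by
    refine (abs_real_inner_le_norm _ _).trans ?_
    refine mul_le_mul (p.2.2.norm_coe_le_norm _) ?_ (norm_nonneg _) (norm_nonneg _)
    have := norm_sub_le z.2 z.1
    linarith
  unfold stJ
  have := abs_add_le (p.1.1 z.1 + p.2.1.1 z.2) (inner ℝ (p.2.2 z.1) (z.2 - z.1))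
  have := abs_add_le (p.1.1 z.1) (p.2.1.1 z.2)
  linarith

def stL {d : ℕ} (μ ν : Measure (E d)) (p : StP d) : ℝ := ∫ x, p.1.1 x ∂μ + ∫ x, p.2.1.1 x ∂ν

def stLlin {d : ℕ} (μ ν : Measure (E d)) [IsProbabilityMeasure μ] [IsProbabilityMeasure ν]
    (hμ : Integrable (id : E d → E d) μ) (hν : Integrable (id : E d → E d) ν) :
    StP d →ₗ[ℝ] ℝ where
  toFun := stL μ ν
  map_add' p q := by
    have h1 := integral_add (st_lg_int μ hμ p.1) (st_lg_int μ hμ q.1)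
    have h2 := integral_add (st_lg_int ν hν p.2.1) (st_lg_int ν hν q.2.1)
    simp only [stL, Prod.fst_add, Prod.snd_add, Submodule.coe_add, Pi.add_apply]
    rw [h1, h2]; ring
  map_smul' c p := by
    simp only [stL, Prod.smul_fst, Prod.smul_snd, Submodule.coe_smul, Pi.smul_apply, smul_eq_mul,
      integral_const_mul, RingHom.id_apply]
    ring

open scoped CompactlySupported in
theorem st_ext {d : ℕ} (μ ν : Measure (E d)) [IsProbabilityMeasure μ] [IsProbabilityMeasure ν]
    (hμ : Integrable (id : E d → E d) μ) (hν : Integrable (id : E d → E d) ν)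
    (hc : ConvexOrder d μ ν) :
    ∃ Λ : C_c(E d × E d, ℝ) →ₚ[ℝ] ℝ, ∀ (p : StP d) (v : C_c(E d × E d, ℝ)),
      (∀ z, 0 ≤ stJ p z + v z) → 0 ≤ stL μ ν p + Λ v := by
  let s : PointedCone ℝ (StP d × C_c(E d × E d, ℝ)) :=
    { carrier := {q | ∀ z, 0 ≤ stJ q.1 z + q.2 z}
      add_mem' := by
        intro q r hq hr z
        have h1 := hq z
        have h2 := hr z
        simp only [Prod.fst_add, Prod.snd_add, stJ_add,
          CompactlySupportedContinuousMap.coe_add, Pi.add_apply]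
        linarith
      zero_mem' := by
        intro z
        simp [stJ]
      smul_mem' := by
        intro c q hq z
        have h1 := mul_nonneg c.2 (hq z)
        have : stJ (c • q).1 z = c.1 * stJ q.1 z := stJ_smul c.1 q.1 z
        rw [this]
        have : (c • q).2 z = c.1 * q.2 z := rfl
        rw [this]
        linarith }
  let f : (StP d × C_c(E d × E d, ℝ)) →ₗ.[ℝ] ℝ :=
    { domain := Submodule.prod ⊤ ⊥
      toFun := (stLlin μ ν hμ hν).comp ((LinearMap.fst ℝ _ _).comp (Submodule.subtype _)) }
  have hnn : ∀ x : f.domain, (x : StP d × C_c(E d × E d, ℝ)) ∈ s → 0 ≤ f x := by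
    rintro ⟨⟨p, v⟩, hx⟩ hs
    have hv : v = 0 := by simpa [f] using hx
    subst hv
    change 0 ≤ stL μ ν p
    obtain ⟨C, hC⟩ := p.2.1.2.2
    refine st_key_pos μ ν hμ hν hc p.1.1 p.2.1.1 (st_lg_int μ hμ _) (st_lg_int ν hν _) C hC
      p.2.2 ?_
    intro x y
    simpa [stJ] using hs (x, y)
  have hdn : ∀ y, ∃ x : f.domain, (x : StP d × C_c(E d × E d, ℝ)) + y ∈ s := by
    rintro ⟨p, v⟩
    obtain ⟨B, hB⟩ := v.continuous.bounded_above_of_compact_support v.hasCompactSupport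
    let c : StLG d := ⟨fun _ => B, continuous_const, |B|, fun x => by
      nlinarith [abs_nonneg B, norm_nonneg x]⟩
    refine ⟨⟨((c, 0, 0) - p, 0), by simp [f]⟩, ?_⟩
    intro z
    have : -B ≤ v z := (abs_le.1 (hB z)).1
    simp [stJ, c]
    linarith
  obtain ⟨g, hg1, hg2⟩ := riesz_extension s f hnn hdn
  · have hgp : ∀ p, g (p, 0) = stL μ ν p := fun p =>
      hg1 ⟨(p, 0), by simp [f]⟩
    have main : ∀ (p : StP d) (v : C_c(E d × E d, ℝ)),
      (∀ z, 0 ≤ stJ p z + v z) → 0 ≤ stL μ ν p + g (0, v) := by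
      intro p v h
      rw [← hgp, ← map_add]
      apply hg2
      intro z
      simpa using h z
    refine ⟨PositiveLinearMap.mk₀ (g.comp (LinearMap.inr ℝ _ _)) ?_, main⟩
    intro v hv
    have := main 0 v (fun z => by simpa [stJ] using hv z)
    simpa [stL] using this

def stChi {d : ℕ} (n : ℕ) (z : E d × E d) : ℝ := max 0 (min 1 (n + 2 - ‖z‖))

def stG {d : ℕ} (n : ℕ) (x : E d) : ℝ := (1 + 2 * ‖x‖) * max 0 (min 1 (‖x‖ - n))

theorem stChi_nonneg {d : ℕ} (n : ℕ) (z : E d × E d) : 0 ≤ stChi n z := le_max_left _ _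

theorem stChi_le {d : ℕ} (n : ℕ) (z : E d × E d) : stChi n z ≤ 1 :=
  max_le zero_le_one (min_le_left _ _)

theorem stChi_cont {d : ℕ} (n : ℕ) : Continuous (stChi (d := d) n) := by
  unfold stChi; fun_prop

theorem stChi_supp {d : ℕ} (n : ℕ) : HasCompactSupport (stChi (d := d) n) := by
  refine HasCompactSupport.intro (isCompact_closedBall (0 : E d × E d) (n + 2)) ?_
  intro z hz
  have : (n : ℝ) + 2 < ‖z‖ := by simpa using hz
  unfold stChi
  rw [max_eq_left]
  exact (min_le_right _ _).trans (by linarith)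

theorem stChi_one {d : ℕ} (n : ℕ) (z : E d × E d) (hz : ‖z‖ ≤ n + 1) : stChi n z = 1 := by
  unfold stChi
  rw [min_eq_left (by linarith)]
  simp

theorem stG_nonneg {d : ℕ} (n : ℕ) (x : E d) : 0 ≤ stG n x :=
  mul_nonneg (by positivity) (le_max_left _ _)

theorem stG_le {d : ℕ} (n : ℕ) (x : E d) : stG n x ≤ 1 + 2 * ‖x‖ := by
  have : max 0 (min 1 (‖x‖ - n)) ≤ 1 := max_le zero_le_one (min_le_left _ _)
  unfold stG
  nlinarith [norm_nonneg x]

theorem stG_eq {d : ℕ} (n : ℕ) (x : E d) (hx : (n : ℝ) + 1 ≤ ‖x‖) : stG n x = 1 + 2 * ‖x‖ := by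
  unfold stG
  rw [min_eq_left (by linarith)]
  simp

theorem stG_cont {d : ℕ} (n : ℕ) : Continuous (stG (d := d) n) := by
  unfold stG; fun_prop

theorem stG_zero {d : ℕ} (n : ℕ) (x : E d) (hx : ‖x‖ ≤ n) : stG n x = 0 := by
  unfold stG
  rw [max_eq_left ((min_le_right _ _).trans (by linarith)), mul_zero]

theorem st_cut {d : ℕ} (n : ℕ) (z : E d × E d) :
    (1 + ‖z.1‖ + ‖z.2‖) * (1 - stChi n z) ≤ stG n z.1 + stG n z.2 := by
  have g1 := stG_nonneg n z.1
  have g2 := stG_nonneg n z.2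
  by_cases hz : ‖z‖ ≤ n + 1
  · rw [stChi_one n z hz]; linarith
  · push Not at hz
    have h0 := stChi_nonneg n z
    have h1 : (1 + ‖z.1‖ + ‖z.2‖) * (1 - stChi n z) ≤ 1 + ‖z.1‖ + ‖z.2‖ := by
      nlinarith [norm_nonneg z.1, norm_nonneg z.2]
    rw [Prod.norm_def] at hz
    rcases le_total ‖z.1‖ ‖z.2‖ with h | h
    · rw [max_eq_right h] at hz
      have := stG_eq n z.2 hz.le
      linarith
    · rw [max_eq_left h] at hz
      have := stG_eq n z.1 hz.le
      linarith

def stGlg {d : ℕ} (n : ℕ) : StLG d := ⟨stG n, stG_cont n, 2, fun x => by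
  rw [abs_of_nonneg (stG_nonneg n x)]
  linarith [stG_le n x]⟩

theorem stG_lim {d : ℕ} (μ : Measure (E d)) [IsProbabilityMeasure μ]
    (hμ : Integrable (id : E d → E d) μ) :
    Tendsto (fun n : ℕ => ∫ x, stG n x ∂μ) atTop (nhds 0) := by
  have hn : Integrable (fun y : E d => ‖y‖) μ := hμ.norm
  have := tendsto_integral_of_dominated_convergence (μ := μ) (F := fun n x => stG n x)
    (f := fun _ => (0:ℝ)) (fun x : E d => 1 + 2 * ‖x‖)
    (fun n => (stG_cont n).aestronglyMeasurable) ((integrable_const 1).add (hn.const_mul 2))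
    (fun n => Eventually.of_forall fun x => by
      rw [Real.norm_eq_abs, abs_of_nonneg (stG_nonneg n x)]; exact stG_le n x)
    (Eventually.of_forall fun x => by
      refine tendsto_const_nhds.congr' ?_
      filter_upwards [eventually_ge_atTop ⌈‖x‖⌉₊] with n hn
      exact (stG_zero n x (Nat.ceil_le.1 hn)).symm)
  simpa using this

theorem stJ_neg {d : ℕ} (p : StP d) (z : E d × E d) : stJ (-p) z = - stJ p z := by
  rw [← neg_one_smul ℝ p, stJ_smul]
  ring

theorem st_chi_lim {d : ℕ} (z : E d × E d) : Tendsto (fun n : ℕ => stChi n z) atTop (nhds 1) := by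
  refine tendsto_const_nhds.congr' ?_
  filter_upwards [eventually_ge_atTop ⌈‖z‖⌉₊] with n hn
  have : ‖z‖ ≤ n := Nat.ceil_le.1 hn
  exact (stChi_one n z (by linarith)).symm

open scoped CompactlySupported in
theorem st_coupling {d : ℕ} (μ ν : Measure (E d)) [IsProbabilityMeasure μ]
    [IsProbabilityMeasure ν]
    (hμ : Integrable (id : E d → E d) μ) (hν : Integrable (id : E d → E d) ν)
    (hc : ConvexOrder d μ ν) :
    ∃ π : Measure (E d × E d), Integrable (fun z => 1 + ‖z.1‖ + ‖z.2‖) π ∧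
      ∀ p : StP d, ∫ z, stJ p z ∂π = stL μ ν p := by
  obtain ⟨Λ, hΛ⟩ := st_ext μ ν hμ hν hc
  let π := RealRMK.rieszMeasure Λ
  let v : ℕ → StP d → C_c(E d × E d, ℝ) := fun n p =>
    { toFun := fun z => stChi n z * stJ p z
      continuous_toFun := (stChi_cont n).mul (stJ_cont p)
      hasCompactSupport' := (stChi_supp n).mul_right }
  have hv : ∀ n p z, v n p z = stChi n z * stJ p z := fun _ _ _ => rfl
  have hπ : ∀ n p, ∫ z, stChi n z * stJ p z ∂π = Λ (v n p) := fun n p =>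
    RealRMK.integral_rieszMeasure Λ (v n p)
  let pw : StP d := (⟨fun x => 1 + ‖x‖, by fun_prop, 1, fun x => by
      rw [abs_of_nonneg (by positivity), one_mul]⟩,
    ⟨fun x => ‖x‖, by fun_prop, 1, fun x => by
      rw [abs_of_nonneg (by positivity), one_mul]; linarith⟩, 0)
  have hpw : ∀ z, stJ pw z = 1 + ‖z.1‖ + ‖z.2‖ := fun z => by simp [stJ, pw]
  have hle : ∀ n, Λ (v n pw) ≤ stL μ ν pw := by
    intro n
    have := hΛ pw (-(v n pw)) (fun z => by
      have h1 : (-(v n pw)) z = -(stChi n z * stJ pw z) := rfl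
      have h2 := stChi_le n z
      have h3 : 0 ≤ stJ pw z := by rw [hpw]; positivity
      rw [h1]; nlinarith)
    rw [map_neg] at this
    linarith
  have hI : Integrable (fun z => stJ pw z) π := by
    refine ⟨(stJ_cont pw).aestronglyMeasurable, ?_⟩
    have h0 : ∀ z, 0 ≤ stJ pw z := fun z => by rw [hpw]; positivity
    rw [hasFiniteIntegral_iff_ofReal (Eventually.of_forall h0)]
    have hf : ∫⁻ z, ENNReal.ofReal (stJ pw z) ∂π
        ≤ liminf (fun n : ℕ => ∫⁻ z, ENNReal.ofReal (stChi n z * stJ pw z) ∂π) atTop := by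
      have : ∀ z, ENNReal.ofReal (stJ pw z)
          = liminf (fun n : ℕ => ENNReal.ofReal (stChi n z * stJ pw z)) atTop := by
        intro z
        refine (Tendsto.liminf_eq ?_).symm
        refine ENNReal.tendsto_ofReal ?_
        simpa using (st_chi_lim z).mul_const (stJ pw z)
      simp_rw [this]
      refine lintegral_liminf_le fun n => ?_
      exact (((stChi_cont n).mul (stJ_cont pw)).measurable).ennreal_ofReal
    refine hf.trans_lt ?_
    refine lt_of_le_of_lt (b := ENNReal.ofReal (stL μ ν pw)) ?_ ENNReal.ofReal_lt_top
    have : ∀ n : ℕ, ∫⁻ z, ENNReal.ofReal (stChi n z * stJ pw z) ∂π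
        ≤ ENNReal.ofReal (stL μ ν pw) := by
      intro n
      rw [← ofReal_integral_eq_lintegral_ofReal]
      · rw [hπ]; exact ENNReal.ofReal_le_ofReal (hle n)
      · exact ((stChi_cont n).mul (stJ_cont pw)).integrable_of_hasCompactSupport
          ((stChi_supp n).mul_right)
      · exact Eventually.of_forall fun z => mul_nonneg (stChi_nonneg n z) (h0 z)
    calc liminf (fun n : ℕ => ∫⁻ z, ENNReal.ofReal (stChi n z * stJ pw z) ∂π) atTop
        ≤ liminf (fun n : ℕ => ENNReal.ofReal (stL μ ν pw)) atTop :=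
          liminf_le_liminf (Eventually.of_forall this)
      _ = _ := by simp
  have hI' : Integrable (fun z : E d × E d => 1 + ‖z.1‖ + ‖z.2‖) π := by
    simpa only [hpw] using hI
  refine ⟨π, hI', fun p => ?_⟩
  have lim1 : Tendsto (fun n : ℕ => ∫ z, stChi n z * stJ p z ∂π) atTop
      (nhds (∫ z, stJ p z ∂π)) := by
    obtain ⟨C, hC0, hC⟩ := stJ_bound p
    refine tendsto_integral_of_dominated_convergence _
      (fun n => ((stChi_cont n).mul (stJ_cont p)).aestronglyMeasurable) (hI'.const_mul C)
      (fun n => Eventually.of_forall fun z => ?_) (Eventually.of_forall fun z => ?_)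
    · rw [norm_mul, Real.norm_eq_abs, Real.norm_eq_abs, abs_of_nonneg (stChi_nonneg n z)]
      have := hC z
      have := stChi_le n z
      nlinarith [abs_nonneg (stJ p z), stChi_nonneg n z]
    · simpa using (st_chi_lim z).mul_const (stJ p z)
  have one : ∀ q : StP d, ∃ C, ∀ n, Λ (v n q) - stL μ ν q
      ≤ C * (∫ x, stG n x ∂μ + ∫ x, stG n x ∂ν) := by
    intro q
    obtain ⟨C, hC0, hC⟩ := stJ_bound q
    refine ⟨C, fun n => ?_⟩
    have := hΛ (q + C • (stGlg n, stGlg n, 0)) (-(v n q)) (fun z => by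
      have h1 : (-(v n q)) z = -(stChi n z * stJ q z) := rfl
      have h2 := stChi_le n z
      have h3 := hC z
      have h4 := st_cut n z
      have h5 : stJ ((stGlg n, stGlg n, 0) : StP d) z = stG n z.1 + stG n z.2 := by
        simp [stJ, stGlg]
      rw [h1, stJ_add, stJ_smul, h5]
      have h6 := mul_le_mul_of_nonneg_left h4 hC0
      have h7 : -(stJ q z) * (1 - stChi n z) ≤ C * (1 + ‖z.1‖ + ‖z.2‖) * (1 - stChi n z) :=
        mul_le_mul_of_nonneg_right ((neg_le_abs _).trans h3) (by linarith)
      linarith)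
    have e : stL μ ν (q + C • (stGlg n, stGlg n, 0)) = stL μ ν q +
        C * (∫ x, stG n x ∂μ + ∫ x, stG n x ∂ν) := by
      have := (stLlin μ ν hμ hν).map_add q (C • (stGlg n, stGlg n, 0))
      rw [map_smul] at this
      exact this
    rw [map_neg, e] at this
    linarith
  have vneg : ∀ n, v n (-p) = - v n p := by
    intro n
    ext z
    change stChi n z * stJ (-p) z = -(stChi n z * stJ p z)
    rw [stJ_neg]; ring
  have Lneg : stL μ ν (-p) = - stL μ ν p := (stLlin μ ν hμ hν).map_neg p
  obtain ⟨C1, h1⟩ := one p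
  obtain ⟨C2, h2⟩ := one (-p)
  have G := (stG_lim μ hμ).add (stG_lim ν hν)
  rw [add_zero] at G
  have lim2 : Tendsto (fun n : ℕ => ∫ z, stChi n z * stJ p z ∂π) atTop (nhds (stL μ ν p)) := by
    have u : Tendsto (fun n : ℕ => stL μ ν p + C1 * (∫ x, stG n x ∂μ + ∫ x, stG n x ∂ν)) atTop
        (nhds (stL μ ν p)) := by simpa using (G.const_mul C1).const_add (stL μ ν p)
    have l : Tendsto (fun n : ℕ => stL μ ν p - C2 * (∫ x, stG n x ∂μ + ∫ x, stG n x ∂ν)) atTop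
        (nhds (stL μ ν p)) := by simpa using (G.const_mul C2).const_sub (stL μ ν p)
    refine tendsto_of_tendsto_of_tendsto_of_le_of_le l u (fun n => ?_) (fun n => ?_)
    · have := h2 n
      rw [vneg, map_neg, Lneg] at this
      simp only [hπ]; linarith
    · have := h1 n
      simp only [hπ]; linarith
  exact tendsto_nhds_unique lim1 lim2

theorem st_cc {d : ℕ} (k : Fin d) : Continuous (fun x : E d => x k) :=
  (EuclideanSpace.proj (𝕜 := ℝ) k).continuous

theorem st_ck {d : ℕ} (m : Measure (E d)) (h : Integrable (id : E d → E d) m) (k : Fin d) :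
    Integrable (fun x : E d => x k) m :=
  (EuclideanSpace.proj (𝕜 := ℝ) k).integrable_comp h

open ProbabilityTheory in
theorem st_strassen {d : ℕ} (μ ν : Measure (E d)) [IsProbabilityMeasure μ]
    [IsProbabilityMeasure ν]
    (hμ : Integrable (id : E d → E d) μ) (hν : Integrable (id : E d → E d) ν)
    (hc : ConvexOrder d μ ν) :
    ∃ K : Kernel (E d) (E d), IsMarkovKernel K ∧ (μ ⊗ₘ K).map Prod.snd = ν ∧
      ∀ k, ∀ᵐ x ∂μ, ∫ y, (y k - x k) ∂(K x) = 0 := by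
  obtain ⟨π, hI, hπ⟩ := st_coupling μ ν hμ hν hc
  have hfin : IsFiniteMeasure π := by
    have h1 : Integrable (fun _ : E d × E d => (1:ℝ)) π := by
      refine hI.mono' aestronglyMeasurable_const (Eventually.of_forall fun z => ?_)
      simp only [norm_one]
      linarith [norm_nonneg z.1, norm_nonneg z.2]
    rcases integrable_const_iff.1 h1 with h | h
    · exact absurd h one_ne_zero
    · exact h
  have bc : ∀ f : BoundedContinuousFunction (E d) ℝ, f ∈ {a : BoundedContinuousFunction (E d) ℝ |
      (a : E d → ℝ) ∈ StLG d} := fun f => ⟨f.continuous, ‖f‖, fun x => by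
        have h1 := f.norm_coe_le_norm x
        rw [Real.norm_eq_abs] at h1
        nlinarith [norm_nonneg x, norm_nonneg f]⟩
  have hfst : π.map Prod.fst = μ := by
    refine ext_of_forall_integral_eq_of_IsFiniteMeasure fun f => ?_
    rw [integral_map measurable_fst.aemeasurable f.continuous.aestronglyMeasurable]
    have := hπ (⟨f, bc f⟩, 0, 0)
    simpa [stJ, stL] using this
  have hsnd : π.map Prod.snd = ν := by
    refine ext_of_forall_integral_eq_of_IsFiniteMeasure fun f => ?_
    rw [integral_map measurable_snd.aemeasurable f.continuous.aestronglyMeasurable]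
    have := hπ (0, ⟨f, bc f⟩, 0)
    simpa [stJ, stL] using this
  have hdis : μ ⊗ₘ π.condKernel = π := by
    have := π.disintegrate π.condKernel
    rwa [Measure.fst, hfst] at this
  refine ⟨π.condKernel, inferInstance, by rw [hdis, hsnd], fun k => ?_⟩
  have hD : Integrable (fun z : E d × E d => z.2 k - z.1 k) π := by
    have h1 := st_ck ν hν k
    have h2 := st_ck μ hμ k
    rw [← hsnd] at h1
    rw [← hfst] at h2
    exact (h1.comp_measurable measurable_snd).sub (h2.comp_measurable measurable_fst)
  have hg : Integrable (fun x => ∫ y, (y k - x k) ∂(π.condKernel x)) μ := by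
    rw [← hdis] at hD
    have := hD.integral_compProd
    simpa using this
  refine ae_eq_zero_of_integral_contDiff_smul_eq_zero hg.locallyIntegrable ?_
  intro f hf hfs
  obtain ⟨B, hB⟩ := hf.continuous.bounded_above_of_compact_support hfs
  let h : BoundedContinuousFunction (E d) (E d) := BoundedContinuousFunction.ofNormedAddCommGroup
    (fun x => f x • EuclideanSpace.single k (1:ℝ)) (hf.continuous.smul continuous_const) B
    (fun x => by rw [norm_smul]; simpa using hB x)
  have := hπ (0, 0, h)
  have e : ∀ z : E d × E d, stJ ((0, 0, h) : StP d) z = f z.1 * (z.2 k - z.1 k) := by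
    intro z
    simp [stJ, h, inner_smul_left, EuclideanSpace.inner_single_left]
  simp only [e] at this
  have hfD : Integrable (fun z : E d × E d => f z.1 * (z.2 k - z.1 k)) π := by
    refine hD.bdd_mul (c := B) ?_ (Eventually.of_forall fun z => hB z.1)
    exact (hf.continuous.comp continuous_fst).aestronglyMeasurable
  rw [← hdis] at this hfD
  rw [Measure.integral_compProd hfD] at this
  simp only [integral_const_mul] at this
  simpa [stL] using this

open ProbabilityTheory in
theorem st_chain {d : ℕ} (N : ℕ) (m : ℕ → Measure (E d))
    (hp : ∀ i ≤ N, IsProbabilityMeasure (m i))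
    (hi : ∀ i ≤ N, Integrable (id : E d → E d) (m i))
    (hc : ∀ i < N, ConvexOrder d (m i) (m (i + 1))) :
    ∀ n ≤ N, ∃ P : Measure (ℕ → E d), IsProbabilityMeasure P ∧
      (∀ i ≤ n, P.map (fun ω => ω i) = m i) ∧
      ∀ i < n, ∀ A : Set (ℕ → E d), MeasurableSet A →
        (∀ ω ω' : ℕ → E d, (∀ j ≤ i, ω j = ω' j) → ω ∈ A → ω' ∈ A) →
        ∀ k, ∫ ω in A, ω (i + 1) k ∂P = ∫ ω in A, ω i k ∂P := by
  intro n
  induction n with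
  | zero =>
    intro _
    have := hp 0 (Nat.zero_le _)
    have hm : Measurable (fun (x : E d) (_ : ℕ) => x) := by fun_prop
    refine ⟨(m 0).map (fun x _ => x), Measure.isProbabilityMeasure_map hm.aemeasurable, ?_,
      fun i hi => absurd hi (Nat.not_lt_zero i)⟩
    intro i hi0
    obtain rfl : i = 0 := by omega
    rw [Measure.map_map (measurable_pi_apply 0) hm]
    exact Measure.map_id
  | succ n ih =>
    intro hn
    obtain ⟨P, hP, hmarg, hmart⟩ := ih (by omega)
    have p1 := hp n (by omega)
    have p2 := hp (n + 1) hn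
    have i1 := hi n (by omega)
    have i2 := hi (n + 1) hn
    obtain ⟨K, hK, hKs, hK0⟩ := st_strassen (m n) (m (n + 1)) i1 i2 (hc n (by omega))
    have hev : Measurable (fun ω : ℕ → E d => ω n) := measurable_pi_apply n
    let κ : Kernel (ℕ → E d) (E d) := K.comap (fun ω => ω n) hev
    let R := P ⊗ₘ κ
    have hRf : R.map Prod.fst = P := Measure.fst_compProd P κ
    have hRs : R.map Prod.snd = m (n + 1) := by
      rw [← hKs]
      change (P ⊗ₘ κ).snd = (m n ⊗ₘ K).snd
      rw [Measure.snd_compProd, Measure.snd_compProd]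
      ext s hs
      rw [Measure.bind_apply hs (Kernel.aemeasurable _),
        Measure.bind_apply hs (Kernel.aemeasurable _), ← hmarg n le_rfl,
        lintegral_map (Kernel.measurable_coe K hs) hev]
      rfl
    let U : (ℕ → E d) × E d → (ℕ → E d) := fun z => Function.update z.1 (n + 1) z.2
    have hU : Measurable U := by
      refine measurable_pi_iff.2 fun i => ?_
      by_cases h : i = n + 1
      · subst h
        simpa [U] using measurable_snd
      · have : (fun z => U z i) = fun z => z.1 i := by
          funext z; simp [U, h]
        rw [this]
        exact (measurable_pi_apply i).comp measurable_fst
    have hUi : ∀ i ≤ n, ∀ z, U z i = z.1 i := fun i hi z => by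
      have : i ≠ n + 1 := by omega
      simp [U, this]
    have hUn : ∀ z, U z (n + 1) = z.2 := fun z => by simp [U]
    have hUA : ∀ i ≤ n, ∀ A : Set (ℕ → E d),
        (∀ ω ω' : ℕ → E d, (∀ j ≤ i, ω j = ω' j) → ω ∈ A → ω' ∈ A) →
        U ⁻¹' A = Prod.fst ⁻¹' A := by
      intro i hi A hA
      ext z
      refine ⟨hA _ _ fun j hj => hUi j (by omega) z, hA _ _ fun j hj => (hUi j (by omega) z).symm⟩
    refine ⟨R.map U, Measure.isProbabilityMeasure_map hU.aemeasurable, ?_, ?_⟩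
    · intro i hi
      rw [Measure.map_map (measurable_pi_apply i) hU]
      rcases Nat.lt_or_ge n i with h | h
      · obtain rfl : i = n + 1 := by omega
        rw [← hRs]
        congr 1
        funext z; exact hUn z
      · rw [← hmarg i h]
        conv_rhs => rw [← hRf]
        rw [Measure.map_map (measurable_pi_apply i) measurable_fst]
        congr 1
        funext z; exact hUi i h z
    · intro i hi A hA hAi k
      have hcm : ∀ j, AEStronglyMeasurable (fun ω : ℕ → E d => ω j k) (R.map U) := fun j =>
        ((st_cc k).measurable.comp (measurable_pi_apply j)).aestronglyMeasurable
      rw [setIntegral_map hA (hcm _) hU.aemeasurable, setIntegral_map hA (hcm _) hU.aemeasurable,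
        hUA i (by omega) A hAi]
      rcases Nat.lt_or_ge i n with h | h
      · simp only [hUi (i + 1) (by omega), hUi i (by omega)]
        have := hmart i h A hA hAi k
        have hcm' : ∀ j, AEStronglyMeasurable (fun ω : ℕ → E d => ω j k) (R.map Prod.fst) :=
          fun j => ((st_cc k).measurable.comp (measurable_pi_apply j)).aestronglyMeasurable
        rw [← hRf, setIntegral_map hA (hcm' _) measurable_fst.aemeasurable,
          setIntegral_map hA (hcm' _) measurable_fst.aemeasurable] at this
        exact this
      · obtain rfl : i = n := by omega
        simp only [hUn, hUi i le_rfl]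
        have j1 : Integrable (fun z : (ℕ → E d) × E d => z.2 k) R := by
          have := st_ck _ i2 k
          rw [← hRs] at this
          exact this.comp_measurable measurable_snd
        have j2 : Integrable (fun z : (ℕ → E d) × E d => z.1 i k) R := by
          have := st_ck _ i1 k
          rw [← hmarg i le_rfl, ← hRf, Measure.map_map hev measurable_fst] at this
          exact this.comp_measurable (hev.comp measurable_fst)
        rw [← sub_eq_zero, ← integral_sub j1.integrableOn j2.integrableOn]
        have e : (Prod.fst ⁻¹' A : Set ((ℕ → E d) × E d)) = A ×ˢ univ := by
          ext z; simp
        have hj : IntegrableOn (fun z : (ℕ → E d) × E d => z.2 k - z.1 i k) (A ×ˢ univ) (P ⊗ₘ κ) :=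
          (j1.sub j2).integrableOn
        rw [e]
        refine (Measure.setIntegral_compProd hA MeasurableSet.univ hj).trans ?_
        refine integral_eq_zero_of_ae ?_
        refine ae_restrict_of_ae ?_
        have := hK0 k
        rw [← hmarg i le_rfl] at this
        filter_upwards [ae_of_ae_map hev.aemeasurable this] with ω hω
        simpa [κ] using hω

/-- number of jump times up to `t` -/
def stCount (N : ℕ) (τ : ℕ → ℝ) (t : ℝ) : ℕ := ((Finset.Icc 1 N).filter (fun i => τ i ≤ t)).card

theorem stCount_le (N : ℕ) (τ : ℕ → ℝ) (t : ℝ) : stCount N τ t ≤ N := by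
  have := Finset.card_filter_le (Finset.Icc 1 N) (fun i => τ i ≤ t)
  simpa [stCount] using this

theorem stCount_mono (N : ℕ) (τ : ℕ → ℝ) : Monotone (stCount N τ) := by
  intro s t hst
  refine Finset.card_le_card fun i hi => ?_
  simp only [Finset.mem_filter] at hi ⊢
  exact ⟨hi.1, hi.2.trans hst⟩

theorem stCount_right (N : ℕ) (τ : ℕ → ℝ) (t : ℝ) (B : Set ℝ) (hB : B ⊆ Ioi t) :
    ∀ᶠ u in nhdsWithin t B, stCount N τ u = stCount N τ t := by
  have : ∀ᶠ u in nhdsWithin t B, ∀ i ∈ Finset.Icc 1 N, (τ i ≤ u ↔ τ i ≤ t) := by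
    rw [Filter.eventually_all_finset]
    intro i _
    by_cases h : τ i ≤ t
    · filter_upwards [self_mem_nhdsWithin] with u hu
      have : t < u := hB hu
      exact ⟨fun _ => h, fun _ => by linarith⟩
    · push Not at h
      filter_upwards [mem_nhdsWithin_of_mem_nhds (Iio_mem_nhds h)] with u hu
      have : u < τ i := hu
      exact ⟨fun h' => by linarith, fun h' => by linarith⟩
  filter_upwards [this] with u hu
  unfold stCount
  rw [Finset.filter_congr hu]

theorem stCount_left (N : ℕ) (τ : ℕ → ℝ) (t : ℝ) (B : Set ℝ) (hB : B ⊆ Iio t) :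
    ∀ᶠ u in nhdsWithin t B,
      stCount N τ u = ((Finset.Icc 1 N).filter (fun i => τ i < t)).card := by
  have : ∀ᶠ u in nhdsWithin t B, ∀ i ∈ Finset.Icc 1 N, (τ i ≤ u ↔ τ i < t) := by
    rw [Filter.eventually_all_finset]
    intro i _
    by_cases h : τ i < t
    · filter_upwards [mem_nhdsWithin_of_mem_nhds (Ioi_mem_nhds h)] with u hu
      exact ⟨fun _ => h, fun _ => le_of_lt hu⟩
    · filter_upwards [self_mem_nhdsWithin] with u hu
      have : u < t := hB hu
      push Not at h
      exact ⟨fun h' => by linarith, fun h' => by linarith⟩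
  filter_upwards [this] with u hu
  unfold stCount
  rw [Finset.filter_congr hu]

def stOne (d : ℕ) : E d := WithLp.toLp 2 (fun _ => (1:ℝ))

open Classical in
def stFix {d : ℕ} (x : E d) : E d := if ∀ k, 0 < x k then x else stOne d

theorem st_pos_meas (d : ℕ) : MeasurableSet {x : E d | ∀ k, 0 < x k} := by
  rw [Set.ofPred_forall]
  exact MeasurableSet.iInter fun k => measurableSet_lt measurable_const (st_cc k).measurable

theorem stFix_meas {d : ℕ} : Measurable (stFix (d := d)) := by
  classical
  exact Measurable.ite (st_pos_meas d) measurable_id measurable_const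

theorem stFix_pos {d : ℕ} (x : E d) (k : Fin d) : 0 < stFix x k := by
  classical
  unfold stFix
  split_ifs with h
  · exact h k
  · simp [stOne]

/-- the positive version of the chain -/
def stY {d : ℕ} (ω : ℕ → E d) : ℕ → E d
  | 0 => stOne d
  | (i + 1) => stFix (ω (i + 1))

theorem stY_pos {d : ℕ} (ω : ℕ → E d) (i : ℕ) (k : Fin d) : 0 < stY ω i k := by
  cases i with
  | zero => simp [stY, stOne]
  | succ i => exact stFix_pos _ k

theorem stY_meas {d : ℕ} (i : ℕ) : Measurable (fun ω : ℕ → E d => stY ω i) := by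
  cases i with
  | zero => exact measurable_const
  | succ i => exact stFix_meas.comp (measurable_pi_apply (i + 1))

theorem st_path_mem {d : ℕ} (N : ℕ) (T : ℝ) (τ : ℕ → ℝ) (h0 : ∀ i ∈ Finset.Icc 1 N, 0 < τ i)
    (hT : ∀ i ∈ Finset.Icc 1 N, τ i < T) (ω : ℕ → E d) :
    (fun t => stY ω (stCount N τ t)) ∈ DPos d T := by
  have hcl : ∀ (t : ℝ) (B : Set ℝ) (n : ℕ), (∀ᶠ u in nhdsWithin t B, stCount N τ u = n) →
      Tendsto (fun t => stY ω (stCount N τ t)) (nhdsWithin t B) (nhds (stY ω n)) := by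
    intro t B n h
    refine tendsto_const_nhds.congr' ?_
    filter_upwards [h] with u hu
    rw [hu]
  refine ⟨⟨fun t _ => ?_, fun t _ => ?_⟩, ?_, ?_, fun t _ k => stY_pos _ _ k⟩
  · exact hcl _ _ _ (stCount_right N τ t _ fun u hu => hu.1)
  · exact ⟨_, hcl _ _ _ (stCount_left N τ t _ fun u hu => hu.2)⟩
  · refine hcl _ _ _ ?_
    filter_upwards [stCount_left N τ T (Ico 0 T) fun u hu => hu.2] with u hu
    rw [hu]
    unfold stCount
    rw [Finset.filter_congr (q := fun i => τ i ≤ T)]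
    intro i hi
    exact ⟨fun h => h.le, fun _ => hT i hi⟩
  · intro k
    have : stCount N τ 0 = 0 := by
      unfold stCount
      rw [Finset.card_eq_zero, Finset.filter_eq_empty_iff]
      intro i hi
      exact not_le.2 (h0 i hi)
    simp [this, stY, stOne]

theorem st_canFilt_dep {d : ℕ} {T s : ℝ} (A : Set ↥(DPos d T)) (hA : MeasurableSet[canFilt d T s] A)
    (ω ω' : ↥(DPos d T)) (h : ∀ u, 0 ≤ u → u ≤ s → (ω : ℝ → E d) u = (ω' : ℝ → E d) u) :
    ω ∈ A ↔ ω' ∈ A := by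
  let m : MeasurableSpace ↥(DPos d T) :=
    { MeasurableSet' := fun A => (ω ∈ A ↔ ω' ∈ A)
      measurableSet_empty := by simp
      measurableSet_compl := by
        intro A hA
        simp only [Set.mem_compl_iff]
        exact not_congr hA
      measurableSet_iUnion := by
        intro f hf
        simp only [Set.mem_iUnion]
        exact exists_congr hf }
  have hle : canFilt d T s ≤ m := by
    refine iSup_le fun u => ?_
    rintro _ ⟨B, _, rfl⟩
    change (ω ∈ _ ↔ ω' ∈ _)
    simp only [Set.mem_preimage]
    rw [h u.1 u.2.1 u.2.2]
  exact hle A hA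

theorem st_dirac_order {d : ℕ} (μ : Measure (E d)) [IsProbabilityMeasure μ]
    (hμ : Integrable (id : E d → E d) μ) (hb : ∀ k : Fin d, ∫ x, x k ∂μ = 1) :
    ConvexOrder d (Measure.dirac (stOne d)) μ := by
  intro Φ hΦ _ hi
  have hcont : Continuous Φ := by
    rw [← continuousOn_univ]; exact hΦ.continuousOn isOpen_univ
  have := hΦ.map_integral_le hcont.continuousOn isClosed_univ
    (Eventually.of_forall fun x => Set.mem_univ (id x)) hμ hi
  have e : ∫ x, id x ∂μ = stOne d := by
    ext k
    have := (EuclideanSpace.proj (𝕜 := ℝ) k).integral_comp_comm hμ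
    simp only [id] at this ⊢
    have h2 : ∫ x : E d, x k ∂μ = (∫ x : E d, x ∂μ) k := this
    rw [← h2, hb k]; rfl
  rw [e] at this
  rw [integral_dirac]
  exact this

theorem st_chain_iter {d : ℕ} (N : ℕ) (P : Measure (ℕ → E d))
    (h : ∀ i < N, ∀ A : Set (ℕ → E d), MeasurableSet A →
        (∀ ω ω' : ℕ → E d, (∀ j ≤ i, ω j = ω' j) → ω ∈ A → ω' ∈ A) →
        ∀ k, ∫ ω in A, ω (i + 1) k ∂P = ∫ ω in A, ω i k ∂P)
    (i : ℕ) (A : Set (ℕ → E d)) (hA : MeasurableSet A)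
    (hAi : ∀ ω ω' : ℕ → E d, (∀ j ≤ i, ω j = ω' j) → ω ∈ A → ω' ∈ A) (k : Fin d)
    (j : ℕ) (hij : i ≤ j) (hj : j ≤ N) :
    ∫ ω in A, ω j k ∂P = ∫ ω in A, ω i k ∂P := by
  induction j, hij using Nat.le_induction with
  | base => rfl
  | succ j hij ih =>
    rw [h j (by omega) A hA (fun ω ω' hω => hAi ω ω' fun l hl => hω l (by omega)) k]
    exact ih (by omega)

/-- given `0 < T_1 < ⋯ < T_N = T` and probability measures
`μ_1 ⪯ ⋯ ⪯ μ_N` on `(0,∞)^d`, each with finite first moments and barycenter `(1,…,1)`,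
there exists a martingale measure on the path space whose marginal at each `T_i` is `μ_i`. -/
theorem statement12 (d N : ℕ) (hd : 1 ≤ d) (hN : 1 ≤ N) (T : ℝ) (hT : 0 < T)
    (Ts : ℕ → ℝ) (hTs1 : 0 < Ts 1)
    (hTsmono : ∀ i, 1 ≤ i → i < N → Ts i < Ts (i + 1)) (hTsN : Ts N = T)
    (μs : ℕ → Measure (E d))
    (hprob : ∀ i, 1 ≤ i → i ≤ N → IsProbabilityMeasure (μs i))
    (hsupp : ∀ i, 1 ≤ i → i ≤ N → μs i ({x : E d | ∀ j, 0 < x j}ᶜ) = 0)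
    (hint : ∀ i, 1 ≤ i → i ≤ N → Integrable (id : E d → E d) (μs i))
    (hbary : ∀ i, 1 ≤ i → i ≤ N → ∀ k : Fin d, ∫ x, x k ∂(μs i) = 1)
    (hconv : ∀ i j, 1 ≤ i → i ≤ j → j ≤ N → ConvexOrder d (μs i) (μs j)) :
    ∃ Q : Measure ↥(DPos d T), IsMartingaleMeasure d T Q ∧
      ∀ i, 1 ≤ i → i ≤ N →
        Measure.map (fun ω : ↥(DPos d T) => (ω : ℝ → E d) (Ts i)) Q = μs i := by
  classical
  -- marginals, including time zero
  let m : ℕ → Measure (E d) := fun i => if i = 0 then Measure.dirac (stOne d) else μs i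
  have m0 : m 0 = Measure.dirac (stOne d) := by simp [m]
  have ms : ∀ i, 1 ≤ i → m i = μs i := fun i hi => by
    have : i ≠ 0 := by omega
    simp [m, this]
  have hp : ∀ i ≤ N, IsProbabilityMeasure (m i) := by
    intro i hi
    rcases Nat.eq_zero_or_pos i with h | h
    · subst h; rw [m0]; infer_instance
    · rw [ms i h]; exact hprob i h hi
  have hii : ∀ i ≤ N, Integrable (id : E d → E d) (m i) := by
    intro i hi
    rcases Nat.eq_zero_or_pos i with h | h
    · subst h; rw [m0]
      exact (integrable_const (stOne d)).congr (by
        rw [EventuallyEq, ae_dirac_eq]; rfl)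
    · rw [ms i h]; exact hint i h hi
  have hcc : ∀ i < N, ConvexOrder d (m i) (m (i + 1)) := by
    intro i hi
    rw [ms (i + 1) (by omega)]
    rcases Nat.eq_zero_or_pos i with h | h
    · subst h
      rw [m0]
      have := hprob 1 le_rfl hN
      exact st_dirac_order _ (hint 1 le_rfl hN) (hbary 1 le_rfl hN)
    · rw [ms i h]; exact hconv i (i + 1) h (by omega) (by omega)
  obtain ⟨P, hP, hmarg, hmart⟩ := st_chain N m hp hii hcc N le_rfl
  -- jump times
  have hTlt : ∀ i j, 1 ≤ i → i < j → j ≤ N → Ts i < Ts j := by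
    intro i j hi hij hj
    induction j, hij using Nat.le_induction with
    | base => exact hTsmono i hi (by omega)
    | succ j hij' ih => exact (ih (by omega)).trans (hTsmono j (by omega) (by omega))
  let τ : ℕ → ℝ := fun i => if i = 1 then Ts 1 / 2 else (Ts (i - 1) + Ts i) / 2
  have τ1 : τ 1 = Ts 1 / 2 := by simp [τ]
  have τs : ∀ i, 2 ≤ i → τ i = (Ts (i - 1) + Ts i) / 2 := fun i hi => by
    have : i ≠ 1 := by omega
    simp [τ, this]
  have hTpos : ∀ i, 1 ≤ i → i ≤ N → 0 < Ts i := by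
    intro i hi hiN
    rcases eq_or_lt_of_le hi with h | h
    · rw [← h]; exact hTs1
    · exact hTs1.trans (hTlt 1 i le_rfl h hiN)
  have τlt : ∀ i, 1 ≤ i → i ≤ N → τ i < Ts i := by
    intro i hi hiN
    rcases eq_or_lt_of_le hi with h | h
    · rw [← h, τ1]; linarith
    · rw [τs i h]
      have := hTlt (i - 1) i (by omega) (by omega) hiN
      linarith
  have τgt : ∀ i, 2 ≤ i → i ≤ N → Ts (i - 1) < τ i := by
    intro i hi hiN
    rw [τs i hi]
    have := hTlt (i - 1) i (by omega) (by omega) hiN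
    linarith
  have τpos : ∀ i ∈ Finset.Icc 1 N, 0 < τ i := by
    intro i hi
    rw [Finset.mem_Icc] at hi
    rcases eq_or_lt_of_le hi.1 with h | h
    · rw [← h, τ1]; linarith
    · exact (hTpos (i - 1) (by omega) (by omega)).trans (τgt i h hi.2)
  have hTle : ∀ i j, 1 ≤ i → i ≤ j → j ≤ N → Ts i ≤ Ts j := by
    intro i j hi hij hj
    rcases eq_or_lt_of_le hij with h | h
    · rw [h]
    · exact (hTlt i j hi h hj).le
  have τT : ∀ i ∈ Finset.Icc 1 N, τ i < T := by
    intro i hi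
    rw [Finset.mem_Icc] at hi
    have := hTle i N hi.1 hi.2 le_rfl
    have := τlt i hi.1 hi.2
    linarith
  have hcount : ∀ i, 1 ≤ i → i ≤ N → stCount N τ (Ts i) = i := by
    intro i hi hiN
    have : (Finset.Icc 1 N).filter (fun j => τ j ≤ Ts i) = Finset.Icc 1 i := by
      ext j
      simp only [Finset.mem_filter, Finset.mem_Icc]
      constructor
      · rintro ⟨⟨h1, h2⟩, h3⟩
        refine ⟨h1, ?_⟩
        by_contra hcon
        have := τgt j (by omega) h2
        have := hTle i (j - 1) hi (by omega) (by omega)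
        linarith
      · rintro ⟨h1, h2⟩
        refine ⟨⟨h1, by omega⟩, ?_⟩
        have := τlt j h1 (by omega)
        have := hTle j i h1 h2 hiN
        linarith
    unfold stCount
    rw [this]; simp
  -- the path map
  let F : (ℕ → E d) → ↥(DPos d T) := fun ω =>
    ⟨fun t => stY ω (stCount N τ t), st_path_mem N T τ τpos τT ω⟩
  have hFv : ∀ ω t, (F ω : ℝ → E d) t = stY ω (stCount N τ t) := fun _ _ => rfl
  have hF : Measurable F := by
    rw [measurable_iff_le_map]
    refine iSup_le fun t => ?_
    rintro _ ⟨B, hB, rfl⟩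
    exact stY_meas (stCount N τ t.1) hB
  have hev : ∀ t, 0 ≤ t → t ≤ T → Measurable (fun ω : ↥(DPos d T) => (ω : ℝ → E d) t) := by
    intro t h0 h1
    rw [measurable_iff_comap_le]
    exact le_iSup (fun t : Set.Icc (0:ℝ) T =>
      MeasurableSpace.comap (fun ω : ↥(DPos d T) => (ω : ℝ → E d) t.1) inferInstance) ⟨t, h0, h1⟩
  -- the modified chain agrees almost surely
  have hY : ∀ i ≤ N, ∀ᵐ ω ∂P, stY ω i = ω i := by
    intro i hi
    have hmi := hmarg i hi
    rcases Nat.eq_zero_or_pos i with h | h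
    · subst h
      rw [m0] at hmi
      have : ∀ᵐ x ∂(P.map (fun ω => ω 0)), x = stOne d := by
        rw [hmi, ae_dirac_eq]; exact rfl
      filter_upwards [ae_of_ae_map (measurable_pi_apply 0).aemeasurable this] with ω hω
      rw [hω]; rfl
    · rw [ms i h] at hmi
      have : ∀ᵐ x ∂(P.map (fun ω => ω i)), ∀ k, 0 < x k := by
        rw [hmi]; exact hsupp i h hi
      filter_upwards [ae_of_ae_map (measurable_pi_apply i).aemeasurable this] with ω hω
      obtain ⟨j, rfl⟩ : ∃ j, i = j + 1 := ⟨i - 1, by omega⟩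
      simp only [stY, stFix]
      rw [if_pos hω]
  have hYlaw : ∀ i ≤ N, P.map (fun ω => stY ω i) = m i := by
    intro i hi
    rw [← hmarg i hi]
    exact Measure.map_congr (hY i hi)
  have hlaw : ∀ t, 0 ≤ t → t ≤ T →
      (P.map F).map (fun ω : ↥(DPos d T) => (ω : ℝ → E d) t) = m (stCount N τ t) := by
    intro t h0 h1
    rw [Measure.map_map (hev t h0 h1) hF]
    exact hYlaw _ (stCount_le N τ t)
  have hQ : IsProbabilityMeasure (P.map F) := Measure.isProbabilityMeasure_map hF.aemeasurable
  have hQint : ∀ t ∈ Set.Icc (0:ℝ) T,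
      Integrable (fun ω : ↥(DPos d T) => (ω : ℝ → E d) t) (P.map F) := by
    intro t ht
    have := hii _ (stCount_le N τ t)
    rw [← hlaw t ht.1 ht.2] at this
    exact this.comp_measurable (hev t ht.1 ht.2)
  refine ⟨P.map F, ⟨hQ, hQint, ?_⟩, ?_⟩
  · intro s t hs hst htT k
    have hle : canFilt d T s ≤ pathSigma d T := by
      refine iSup_le fun u => ?_
      exact measurable_iff_comap_le.1 (hev u.1 u.2.1 (by linarith [u.2.2]))
    have hqk : ∀ t ∈ Set.Icc (0:ℝ) T,
        Integrable (fun ω : ↥(DPos d T) => (ω : ℝ → E d) t k) (P.map F) := fun t ht =>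
      (EuclideanSpace.proj (𝕜 := ℝ) k).integrable_comp (hQint t ht)
    have hs' : s ∈ Set.Icc (0:ℝ) T := ⟨hs, hst.trans htT⟩
    have ht' : t ∈ Set.Icc (0:ℝ) T := ⟨hs.trans hst, htT⟩
    refine ae_eq_condExp_of_forall_setIntegral_eq hle (hqk t ht')
      (fun A _ _ => (hqk s hs').integrableOn) ?_ ?_
    · intro A hA _
      have hA' := hle A hA
      rw [setIntegral_map hA' (hqk s hs').aestronglyMeasurable hF.aemeasurable,
        setIntegral_map hA' (hqk t ht').aestronglyMeasurable hF.aemeasurable]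
      have red : ∀ u, ∫ ω in F ⁻¹' A, (F ω : ℝ → E d) u k ∂P
          = ∫ ω in F ⁻¹' A, ω (stCount N τ u) k ∂P := by
        intro u
        refine integral_congr_ae (ae_restrict_of_ae ?_)
        filter_upwards [hY _ (stCount_le N τ u)] with ω hω
        rw [hFv, hω]
      rw [red, red]
      refine (st_chain_iter N P hmart (stCount N τ s) (F ⁻¹' A) (hF hA') ?_ k _
        (stCount_mono N τ hst) (stCount_le N τ t)).symm
      intro ω ω' hω hmem
      refine (st_canFilt_dep A hA (F ω) (F ω') ?_).1 hmem
      intro u _ hus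
      rw [hFv, hFv]
      have := hω _ (stCount_mono N τ hus)
      generalize stCount N τ u = c at this
      cases c with
      | zero => rfl
      | succ c => simp only [stY]; rw [this]
    · have hm : Measurable[canFilt d T s] (fun ω : ↥(DPos d T) => (ω : ℝ → E d) s) := by
        rw [measurable_iff_comap_le]
        exact le_iSup (fun u : {u : ℝ // 0 ≤ u ∧ u ≤ s} =>
          MeasurableSpace.comap (fun ω : ↥(DPos d T) => (ω : ℝ → E d) u.1) inferInstance)
          ⟨s, hs, le_rfl⟩
      have hm2 : Measurable[canFilt d T s] (fun ω : ↥(DPos d T) => (ω : ℝ → E d) s k) :=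
        (st_cc k).measurable.comp hm
      exact hm2.stronglyMeasurable.aestronglyMeasurable
  · intro i hi hiN
    have h1 := hTpos i hi hiN
    have h2 := hTle i N hi hiN le_rfl
    rw [hlaw (Ts i) h1.le (by linarith), hcount i hi hiN, ms i hi]

end
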